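/- Let c ∈ 𝕋 with c ≠ 0, let 0 < δ < 1/2, and let μ be a non-atomic g-measure for g^c. Then there exists a constant R > 0 (depending on c and δ) such that for every n ∈ ℕ, every interval I ⊂ 𝕋 of length 2^{−n}, and every x ∈ I ∩ K^c_δ: R^{−1}·exp(ψ^c_n(x)) ≤ μ(I) ≤ R·exp(ψ^c_n(x)). -/

import Mathlib

open MeasureTheory Filter Topology Set
open scoped ENNReal

noncomputable section

namespace GTM

abbrev Torus := AddCircle (1 : ℝ)

instance : Fact ((0:ℝ) < 1) := ⟨one_pos⟩

/-- The doubling map on the torus. -/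
def dbl (x : Torus) : Torus := x + x

/-- The function `x ↦ |cos (π x)|` lifted to the torus. -/
def absCos : Torus → ℝ :=
  Function.Periodic.lift (f := fun x : ℝ => |Real.cos (Real.pi * x)|)
    (by
      intro x
      simp [mul_add, mul_one, Real.cos_add_pi, abs_neg])

/-- The potential `ψ^c(x) = 2 log |cos (π (x - c))|`, with value `⊥ = -∞` at the
singularity `c + 1/2`. -/
def psi (c : Torus) (x : Torus) : EReal :=
  if absCos (x - c) = 0 then ⊥ else ((2 * Real.log (absCos (x - c)) : ℝ) : EReal)

/-- The Birkhoff sums `ψ^c_n` of the potential `ψ^c` under the doubling map. -/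
def psiSum (c : Torus) (n : ℕ) (x : Torus) : EReal :=
  ∑ k ∈ Finset.range n, psi c (dbl^[k] x)

/-- The left endpoint of the dyadic cylinder interval of a binary word. -/
def wordVal (n : ℕ) (ω : Fin n → Bool) : ℝ :=
  ∑ i : Fin n, (if ω i then (1 : ℝ) else 0) / 2 ^ ((i : ℕ) + 1)

/-- The closed dyadic interval `⟨ω⟩ ⊆ 𝕋` associated to a binary word `ω`. -/
def cyl (n : ℕ) (ω : Fin n → Bool) : Set Torus :=
  (fun x : ℝ => (x : Torus)) '' Set.Icc (wordVal n ω) (wordVal n ω + 1 / 2 ^ n)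

/-- The exponential function on extended reals, `exp ⊥ = 0`, `exp ⊤ = ∞`. -/
def eexp (x : EReal) : ℝ≥0∞ :=
  if x = ⊥ then 0 else if x = ⊤ then ⊤ else ENNReal.ofReal (Real.exp x.toReal)

/-- The logarithm on `ℝ≥0∞`, `log 0 = ⊥`, `log ∞ = ⊤`. -/
def elog (x : ℝ≥0∞) : EReal :=
  if x = 0 then ⊥ else if x = ⊤ then ⊤ else ((Real.log x.toReal : ℝ) : EReal)

/-- The partition function `Σ_{ω ∈ {0,1}ⁿ} exp (t · sup_{x ∈ ⟨ω⟩} ψ^c_n(x))`. -/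
def presZ (c : Torus) (t : ℝ) (n : ℕ) : ℝ≥0∞ :=
  ∑ ω : Fin n → Bool, eexp ((t : EReal) * ⨆ x ∈ cyl n ω, psiSum c n x)

/-- The upper topological pressure `P̄_top(t ψ^c)`. -/
def presUpper (c : Torus) (t : ℝ) : EReal :=
  atTop.limsup fun n : ℕ => (((n : ℝ)⁻¹ : ℝ) : EReal) * elog (presZ c t n)

/-- The lower topological pressure `P̲_top(t ψ^c)`. -/
def presLower (c : Torus) (t : ℝ) : EReal :=
  atTop.liminf fun n : ℕ => (((n : ℝ)⁻¹ : ℝ) : EReal) * elog (presZ c t n)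

/-- The `g`-function `g^c(x) = cos² (π (x - c))`. -/
def gfun (c : Torus) (x : Torus) : ℝ := (absCos (x - c)) ^ 2

/-- The halving map `x ↦ x/2` on the torus, computed on the representative in `[0,1)`. -/
def half (x : Torus) : Torus := (((AddCircle.equivIco 1 0 x : ℝ) / 2 : ℝ) : Torus)

/-- `μ` is a `g`-measure for `g^c`: it is a Borel probability measure invariant under the
dual transfer operator of `g^c`. -/
def IsGMeasure (c : Torus) (μ : Measure Torus) : Prop :=
  IsProbabilityMeasure μ ∧
    ∀ f : C(Torus, ℝ),
      ∫ x, f x ∂μ =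
        ∫ x,
          (gfun c (half x) * f (half x) +
            gfun c (half x + (((1 : ℝ) / 2 : ℝ) : Torus)) *
              f (half x + (((1 : ℝ) / 2 : ℝ) : Torus))) ∂μ

/-- The singularity position `c̆ = c + 1/2`. -/
def breve (c : Torus) : Torus := c + (((1 : ℝ) / 2 : ℝ) : Torus)

/-- `K^c_δ = {x ∈ 𝕋 : ρ(Tⁿ x, c̆) ≥ δ for all n ≥ 0}`. -/
def Kdelta (c : Torus) (δ : ℝ) : Set Torus :=
  {x | ∀ n : ℕ, δ ≤ dist (dbl^[n] x) (breve c)}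

theorem absCos_coe (t : ℝ) : absCos (t : Torus) = |Real.cos (Real.pi * t)| := rfl

theorem absCos_nonneg (x : Torus) : 0 ≤ absCos x := by
  induction x using QuotientAddGroup.induction_on with | H t => exact abs_nonneg _

theorem continuous_absCos : Continuous absCos :=
  continuous_coinduced_dom.mpr (by
    change Continuous fun x : ℝ => |Real.cos (Real.pi * x)|
    fun_prop)

theorem continuous_gfun (c : Torus) : Continuous (gfun c) :=
  (continuous_absCos.comp (continuous_id.sub continuous_const)).pow 2

theorem gfun_nonneg (c x : Torus) : 0 ≤ gfun c x := sq_nonneg _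

theorem gfun_coe (c t : ℝ) : gfun c t = Real.cos (Real.pi * (t - c)) ^ 2 := by
  rw [gfun, ← AddCircle.coe_sub, absCos_coe, sq_abs]

theorem gfun_le_one (c x : Torus) : gfun c x ≤ 1 := by
  induction c using QuotientAddGroup.induction_on with | H c =>
  induction x using QuotientAddGroup.induction_on with | H t =>
  rw [gfun_coe]
  exact Real.cos_sq_le_one _

theorem abs_gfun_sub_le (c : Torus) (s t : ℝ) :
    |gfun c s - gfun c t| ≤ 2 * Real.pi * |s - t| := by
  induction c using QuotientAddGroup.induction_on with | H c =>
  rw [gfun_coe, gfun_coe, sq_sub_sq, abs_mul]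
  have h1 := Real.abs_cos_le_one (Real.pi * (s - c))
  have h2 := Real.abs_cos_le_one (Real.pi * (t - c))
  have h3 := abs_add_le (Real.cos (Real.pi * (s - c))) (Real.cos (Real.pi * (t - c)))
  have h4 : |Real.cos (Real.pi * (s - c)) - Real.cos (Real.pi * (t - c))| ≤
      Real.pi * |s - t| := by
    have := Real.lipschitzWith_cos.dist_le_mul (Real.pi * (s - c)) (Real.pi * (t - c))
    rw [Real.dist_eq, Real.dist_eq, ← mul_sub, abs_mul, abs_of_pos Real.pi_pos] at this
    simpa using this
  calc _ ≤ 2 * (Real.pi * |s - t|) := by gcongr; linarith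
    _ = _ := by ring

theorem eq_breve_of_gfun_eq_zero {c x : Torus} (h : gfun c x = 0) : x = breve c := by
  induction c using QuotientAddGroup.induction_on with | H c =>
  induction x using QuotientAddGroup.induction_on with | H t =>
  rw [gfun_coe, sq_eq_zero_iff, Real.cos_eq_zero_iff] at h
  obtain ⟨k, hk⟩ := h
  have ht : t = c + 1 / 2 + k := by
    have := Real.pi_pos
    apply mul_left_cancel₀ this.ne'
    linarith
  rw [breve, ← AddCircle.coe_add]
  apply (QuotientAddGroup.eq).mpr
  rw [AddSubgroup.mem_zmultiples_iff]
  exact ⟨-k, by rw [ht]; simp; ring⟩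

/-- On the complement of a ball around the singularity, `g^c` is bounded below. -/
theorem exists_pos_le_gfun (c : Torus) {δ : ℝ} (hδ : 0 < δ) :
    ∃ γ : ℝ, 0 < γ ∧ ∀ x, δ ≤ dist x (breve c) → γ ≤ gfun c x := by
  have hK : IsCompact {x : Torus | δ ≤ dist x (breve c)} :=
    (isClosed_le continuous_const (continuous_id.dist continuous_const)).isCompact
  refine hK.exists_forall_le' (continuous_gfun c).continuousOn fun x hx => ?_
  refine (gfun_nonneg c x).lt_of_ne fun h => ?_
  rw [mem_ofPred_eq, eq_breve_of_gfun_eq_zero h.symm, dist_self] at hx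
  exact hδ.not_ge hx

theorem toReal_eexp_psiSum {c x : Torus} (n : ℕ) (hx : ∀ k, gfun c (dbl^[k] x) ≠ 0) :
    (eexp (psiSum c n x)).toReal = ∏ k ∈ Finset.range n, gfun c (dbl^[k] x) := by
  have h0 : ∀ k, absCos (dbl^[k] x - c) ≠ 0 := fun k h => hx k (by rw [gfun, h]; norm_num)
  have h1 : psiSum c n x =
      ((∑ k ∈ Finset.range n, 2 * Real.log (absCos (dbl^[k] x - c)) : ℝ) : EReal) := by
    rw [psiSum]
    induction n with
    | zero => simp
    | succ n ih => rw [Finset.sum_range_succ, ih, Finset.sum_range_succ, psi, if_neg (h0 n),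
        EReal.coe_add]
  rw [h1, eexp, if_neg (EReal.coe_ne_bot _), if_neg (EReal.coe_ne_top _), EReal.toReal_coe,
    ENNReal.toReal_ofReal (Real.exp_pos _).le, Real.exp_sum]
  refine Finset.prod_congr rfl fun k _ => ?_
  rw [gfun, two_mul, Real.exp_add, Real.exp_log ((absCos_nonneg _).lt_of_ne' (h0 k)), sq]

theorem measurable_half : Measurable half := by
  have h := (AddCircle.measurableEquivIco 1 0).measurable
  exact AddCircle.measurable_mk'.comp ((measurable_subtype_coe.comp h).div_const 2)

theorem dbl_coe (t : ℝ) : dbl t = ((2 * t : ℝ) : Torus) := by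
  rw [dbl, ← AddCircle.coe_add, two_mul]

theorem coe_one_half_add_self : (((1 : ℝ) / 2 : ℝ) : Torus) + (((1 : ℝ) / 2 : ℝ) : Torus) = 0 := by
  rw [← AddCircle.coe_add, add_halves]
  exact AddCircle.coe_period 1

theorem coe_one_half_ne_zero : (((1 : ℝ) / 2 : ℝ) : Torus) ≠ 0 := by
  intro h
  rw [← QuotientAddGroup.mk_zero, AddCircle.coe_eq_coe_iff_of_mem_Ico (a := 0)] at h
  all_goals norm_num at *

theorem dbl_half (x : Torus) : dbl (half x) = x := by
  rw [half, dbl_coe, mul_div_cancel₀ _ two_ne_zero]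
  exact AddCircle.coe_equivIco

theorem dbl_half_add (x : Torus) : dbl (half x + (((1 : ℝ) / 2 : ℝ) : Torus)) = x := by
  rw [dbl, add_add_add_comm, coe_one_half_add_self, add_zero]
  exact dbl_half x

theorem eq_or_eq_add_of_dbl_eq {x y : Torus} (h : dbl x = dbl y) :
    x = y ∨ x = y + (((1 : ℝ) / 2 : ℝ) : Torus) := by
  induction x using QuotientAddGroup.induction_on with | H s =>
  induction y using QuotientAddGroup.induction_on with | H t =>
  rw [dbl_coe, dbl_coe] at h
  obtain ⟨k, hk⟩ := AddSubgroup.mem_zmultiples_iff.mp (QuotientAddGroup.eq.mp h)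
  have hk' : t - s = k / 2 := by
    have : (k : ℝ) = -(2 * s) + 2 * t := by simpa using hk
    linarith
  rcases Int.even_or_odd' k with ⟨m, rfl | rfl⟩
  · left
    refine QuotientAddGroup.eq.mpr (AddSubgroup.mem_zmultiples_iff.mpr ⟨m, ?_⟩)
    push_cast at hk'
    simp only [zsmul_eq_mul]
    linarith
  · right
    rw [← AddCircle.coe_add]
    refine QuotientAddGroup.eq.mpr (AddSubgroup.mem_zmultiples_iff.mpr ⟨m + 1, ?_⟩)
    push_cast at hk'
    simp only [zsmul_eq_mul]
    push_cast
    linarith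

/-- The dual transfer operator identity for a `g`-measure, evaluated on Borel sets. -/
theorem IsGMeasure.apply_eq_lintegral {c : Torus} {μ : Measure Torus} (hμ : IsGMeasure c μ)
    {A : Set Torus} (hA : MeasurableSet A) :
    μ A = ∫⁻ x, (A.indicator (fun y => ENNReal.ofReal (gfun c y)) (half x) +
      A.indicator (fun y => ENNReal.ofReal (gfun c y))
        (half x + (((1 : ℝ) / 2 : ℝ) : Torus))) ∂μ := by
  obtain ⟨hprob, hinv⟩ := hμ
  have hg := (continuous_gfun c).measurable
  have hm₁ := measurable_half
  have hm₂ : Measurable fun x => half x + (((1 : ℝ) / 2 : ℝ) : Torus) := hm₁.add_const _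
  have key : ∀ h : Torus → Torus, Measurable h → ∃ ν : Measure Torus, IsFiniteMeasure ν ∧
      (∀ f : BoundedContinuousFunction Torus ℝ,
        ∫ x, f x ∂ν = ∫ x, gfun c (h x) * f (h x) ∂μ) ∧
      ν A = ∫⁻ x, A.indicator (fun y => ENNReal.ofReal (gfun c y)) (h x) ∂μ := by
    intro h hh
    have hgh : Measurable fun x => ENNReal.ofReal (gfun c (h x)) := (hg.comp hh).ennreal_ofReal
    refine ⟨(μ.withDensity fun x => ENNReal.ofReal (gfun c (h x))).map h, ?_, ?_, ?_⟩
    · have : IsFiniteMeasure (μ.withDensity fun x => ENNReal.ofReal (gfun c (h x))) := by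
        refine isFiniteMeasure_withDensity (ne_of_lt ?_)
        calc ∫⁻ x, ENNReal.ofReal (gfun c (h x)) ∂μ ≤ ∫⁻ _, 1 ∂μ := by
              refine lintegral_mono fun x => ?_
              simpa using gfun_le_one c (h x)
          _ < ⊤ := by simp
      infer_instance
    · intro f
      rw [integral_map hh.aemeasurable f.continuous.measurable.aestronglyMeasurable,
        integral_withDensity_eq_integral_toReal_smul hgh (by simp)]
      simp only [smul_eq_mul, ENNReal.toReal_ofReal (gfun_nonneg c _)]
    · rw [Measure.map_apply hh hA, withDensity_apply _ (hh hA), ← lintegral_indicator (hh hA)]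
      rfl
  obtain ⟨ν₁, hf₁, hi₁, ha₁⟩ := key _ hm₁
  obtain ⟨ν₂, hf₂, hi₂, ha₂⟩ := key _ hm₂
  have hint : ∀ h : Torus → Torus, Measurable h → ∀ f : BoundedContinuousFunction Torus ℝ,
      Integrable (fun x => gfun c (h x) * f (h x)) μ := by
    intro h hh f
    refine Integrable.of_bound (C := ‖f‖)
      (((hg.comp hh).mul (f.continuous.measurable.comp hh)).aestronglyMeasurable)
      (Eventually.of_forall fun x => ?_)
    rw [norm_mul, Real.norm_of_nonneg (gfun_nonneg c _)]
    exact (mul_le_of_le_one_left (norm_nonneg _) (gfun_le_one c _)).trans (f.norm_coe_le_norm _)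
  have hμν : μ = ν₁ + ν₂ := by
    refine ext_of_forall_integral_eq_of_IsFiniteMeasure fun f => ?_
    rw [integral_add_measure (f.integrable _) (f.integrable _), hi₁, hi₂,
      ← integral_add (hint _ hm₁ f) (hint _ hm₂ f)]
    exact hinv f.toContinuousMap
  conv_lhs => rw [hμν]
  rw [Measure.add_apply, ha₁, ha₂, lintegral_add_left]
  exact (hg.ennreal_ofReal.indicator hA).comp hm₁

theorem IsGMeasure.mul_image_dbl_le {c : Torus} {μ : Measure Torus} (hμ : IsGMeasure c μ)
    {A : Set Torus} (hA : MeasurableSet A) {s : ℝ} (hs : ∀ x ∈ A, s ≤ gfun c x) :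
    ENNReal.ofReal s * μ (dbl '' A) ≤ μ A := by
  have hm := (continuous_gfun c).measurable.ennreal_ofReal.indicator hA
  rw [hμ.apply_eq_lintegral hA]
  refine le_trans ?_ (mul_meas_ge_le_lintegral ((hm.comp measurable_half).add
    (hm.comp (measurable_half.add_const _))) (ENNReal.ofReal s))
  gcongr
  rintro _ ⟨y, hy, rfl⟩
  have hsy := ENNReal.ofReal_le_ofReal (hs y hy)
  simp only [mem_ofPred_eq, Pi.add_apply, Function.comp_apply]
  rcases eq_or_eq_add_of_dbl_eq (dbl_half (dbl y)).symm with h | h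
  · rw [← h, indicator_of_mem hy]
    exact hsy.trans le_self_add
  · rw [← h, indicator_of_mem hy]
    exact hsy.trans le_add_self

theorem IsGMeasure.le_mul_image_dbl {c : Torus} {μ : Measure Torus} (hμ : IsGMeasure c μ)
    {A : Set Torus} (hA : MeasurableSet A) (hinj : InjOn dbl A) {s : ℝ}
    (hs : ∀ x ∈ A, gfun c x ≤ s) : μ A ≤ ENNReal.ofReal s * μ (dbl '' A) := by
  rw [hμ.apply_eq_lintegral hA]
  refine le_trans (lintegral_mono fun x => ?_) (lintegral_indicator_const_le (dbl '' A) _)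
  have hsy : ∀ y ∈ A, ENNReal.ofReal (gfun c y) ≤ ENNReal.ofReal s := fun y hy =>
    ENNReal.ofReal_le_ofReal (hs y hy)
  by_cases h₁ : half x ∈ A
  · have h₂ : half x + (((1 : ℝ) / 2 : ℝ) : Torus) ∉ A := fun h₂ =>
      coe_one_half_ne_zero (left_eq_add.mp (hinj h₁ h₂ ((dbl_half x).trans (dbl_half_add x).symm)))
    rw [indicator_of_mem h₁, indicator_of_notMem h₂, add_zero,
      indicator_of_mem (show x ∈ dbl '' A from ⟨_, h₁, dbl_half x⟩)]
    exact hsy _ h₁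
  · by_cases h₂ : half x + (((1 : ℝ) / 2 : ℝ) : Torus) ∈ A
    · rw [indicator_of_notMem h₁, indicator_of_mem h₂, zero_add,
        indicator_of_mem (show x ∈ dbl '' A from ⟨_, h₂, dbl_half_add x⟩)]
      exact hsy _ h₂
    · rw [indicator_of_notMem h₁, indicator_of_notMem h₂, add_zero]
      exact zero_le

theorem IsGMeasure.pos_of_image_dbl_pos {c : Torus} {μ : Measure Torus} (hμ : IsGMeasure c μ)
    (hna : ∀ x : Torus, μ {x} = 0) {A : Set Torus} (hA : MeasurableSet A)
    (hpos : 0 < μ (dbl '' A)) : 0 < μ A := by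
  by_contra h
  have hA0 : μ A = 0 := by simpa using h
  have hk : ∀ k : ℕ, μ (dbl '' (A ∩ {x | 1 / ((k : ℝ) + 1) ≤ gfun c x})) = 0 := by
    intro k
    have hmeas : MeasurableSet (A ∩ {x | 1 / ((k : ℝ) + 1) ≤ gfun c x}) :=
      hA.inter (measurableSet_le measurable_const (continuous_gfun c).measurable)
    have h1 := hμ.mul_image_dbl_le hmeas fun x hx => hx.2
    rw [measure_mono_null inter_subset_left hA0, nonpos_iff_eq_zero, mul_eq_zero] at h1
    refine h1.resolve_left ?_
    simp only [ENNReal.ofReal_eq_zero, not_le]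
    positivity
  have hsub : dbl '' A ⊆ {dbl (breve c)} ∪
      ⋃ k : ℕ, dbl '' (A ∩ {x | 1 / ((k : ℝ) + 1) ≤ gfun c x}) := by
    rintro _ ⟨y, hy, rfl⟩
    rcases (gfun_nonneg c y).eq_or_lt with h0 | h0
    · left
      rw [eq_breve_of_gfun_eq_zero h0.symm]
      rfl
    · obtain ⟨k, hk⟩ := exists_nat_one_div_lt h0
      exact Or.inr (mem_iUnion.mpr ⟨k, y, ⟨hy, hk.le⟩, rfl⟩)
  exact hpos.ne' (measure_mono_null hsub
    (measure_union_null (hna _) (measure_iUnion_null hk)))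

/-- The half-open arc of length `2⁻ⁿ` starting at `a`. -/
def arc (n : ℕ) (a : ℝ) : Set Torus :=
  (fun y : ℝ => (y : Torus)) '' Set.Ico a (a + 1 / 2 ^ n)

theorem measurableSet_arc (n : ℕ) (a : ℝ) : MeasurableSet (arc n a) := by
  have hlt : a < a + 1 / 2 ^ n := by simp
  rw [arc, ← Ioo_insert_left hlt, image_insert_eq]
  exact ((QuotientAddGroup.isOpenMap_coe _ isOpen_Ioo).measurableSet).insert _

theorem dbl_image_arc (n : ℕ) (a : ℝ) : dbl '' arc (n + 1) a = arc n (2 * a) := by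
  have hpow : 2 * (1 / 2 ^ (n + 1) : ℝ) = 1 / 2 ^ n := by
    rw [pow_succ]; field_simp
  ext x
  constructor
  · rintro ⟨_, ⟨y, hy, rfl⟩, rfl⟩
    refine ⟨2 * y, ⟨?_, ?_⟩, (dbl_coe y).symm⟩
    · linarith [hy.1]
    · linarith [hy.2]
  · rintro ⟨y, hy, rfl⟩
    refine ⟨_, ⟨y / 2, ⟨?_, ?_⟩, rfl⟩, ?_⟩
    · linarith [hy.1]
    · linarith [hy.2]
    · change dbl ((y / 2 : ℝ) : Torus) = _
      rw [dbl_coe, mul_div_cancel₀ _ two_ne_zero]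

theorem arc_zero (a : ℝ) : arc 0 a = univ := by
  rw [arc, pow_zero, div_one]
  exact AddCircle.coe_image_Ico_eq 1 a

theorem injOn_dbl_arc (n : ℕ) (a : ℝ) : InjOn dbl (arc (n + 1) a) := by
  have hpow : 2 * (1 / 2 ^ (n + 1) : ℝ) ≤ 1 := by
    have : (1 : ℝ) ≤ 2 ^ n := one_le_pow₀ one_le_two
    rw [pow_succ]; field_simp; linarith
  rintro _ ⟨y, hy, rfl⟩ _ ⟨z, hz, rfl⟩ h
  simp only [dbl_coe] at h
  rw [AddCircle.coe_eq_coe_iff_of_mem_Ico (a := 2 * a)] at h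
  · rw [mul_left_cancel₀ two_ne_zero h]
  · exact ⟨by linarith [hy.1], by linarith [hy.2]⟩
  · exact ⟨by linarith [hz.1], by linarith [hz.2]⟩

theorem IsGMeasure.arc_pos {c : Torus} {μ : Measure Torus} (hμ : IsGMeasure c μ)
    (hna : ∀ x : Torus, μ {x} = 0) (n : ℕ) (a : ℝ) : 0 < μ (arc n a) := by
  induction n generalizing a with
  | zero =>
    have := hμ.1
    rw [arc_zero, measure_univ]
    exact one_pos
  | succ n ih =>
    exact hμ.pos_of_image_dbl_pos hna (measurableSet_arc _ _) (by rw [dbl_image_arc]; exact ih _)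

theorem arc_add_int (n : ℕ) (a : ℝ) (k : ℤ) : arc n (a + k) = arc n a := by
  have : Ico (a + k) (a + k + 1 / 2 ^ n) = (fun y : ℝ => y + k) '' Ico a (a + 1 / 2 ^ n) := by
    rw [image_add_const_Ico]
    congr 1
    ring
  rw [arc, this, image_image, arc]
  refine image_congr fun y _ => ?_
  refine QuotientAddGroup.eq.mpr (AddSubgroup.mem_zmultiples_iff.mpr ⟨-k, ?_⟩)
  simp

/-- Arcs of length at least `2⁻ᵐ` have measure uniformly bounded below. -/
theorem IsGMeasure.exists_pos_le_arc {c : Torus} {μ : Measure Torus} (hμ : IsGMeasure c μ)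
    (hna : ∀ x : Torus, μ {x} = 0) (m : ℕ) :
    ∃ κ : ℝ, 0 < κ ∧ ∀ n ≤ m, ∀ a : ℝ, κ ≤ μ.real (arc n a) := by
  have := hμ.1
  set N : ℕ := 2 ^ (m + 1) with hN
  have hN0 : 0 < N := by positivity
  have hNR : (0 : ℝ) < N := by exact_mod_cast hN0
  obtain ⟨j₀, -, hj₀⟩ := Finset.exists_min_image (Finset.range N)
    (fun j : ℕ => μ.real (arc (m + 1) (j / N))) ⟨0, Finset.mem_range.mpr hN0⟩
  refine ⟨μ.real (arc (m + 1) (j₀ / N)), ?_, fun n hn a => ?_⟩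
  · exact ENNReal.toReal_pos (hμ.arc_pos hna _ _).ne' (measure_ne_top _ _)
  set j : ℤ := ⌈a * N⌉ with hj
  have hmod : (j : ℝ) / N = ((j % N).toNat : ℕ) / N + (j / N : ℤ) := by
    have h1 : ((j % N).toNat : ℤ) = j % N :=
      Int.toNat_of_nonneg (Int.emod_nonneg _ (by exact_mod_cast hN0.ne'))
    have h2 : ((j % N).toNat : ℝ) = ((j % N : ℤ) : ℝ) := by exact_mod_cast h1
    have h3 : (j : ℝ) = (j % N : ℤ) + N * (j / N : ℤ) := by
      exact_mod_cast (Int.emod_add_mul_ediv j N).symm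
    rw [h2]
    conv_lhs => rw [h3]
    field_simp
  have hlt : (j % N).toNat < N := by
    have := Int.emod_lt_of_pos j (by exact_mod_cast hN0 : (0 : ℤ) < N)
    omega
  refine (hj₀ _ (Finset.mem_range.mpr hlt)).trans ?_
  rw [← arc_add_int _ _ (j / N), ← hmod]
  refine measureReal_mono (image_mono (Ico_subset_Ico ?_ ?_))
  · rw [le_div_iff₀ hNR]
    exact Int.le_ceil _
  · have h1 : (j : ℝ) / N ≤ a + 1 / N := by
      rw [div_le_iff₀ hNR, add_mul, one_div_mul_cancel hNR.ne']
      exact (Int.ceil_lt_add_one _).le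
    have h2 : (1 : ℝ) / N + 1 / 2 ^ (m + 1) = 1 / 2 ^ m := by
      rw [hN]; push_cast; rw [pow_succ]; field_simp; norm_num
    have h3 : (1 : ℝ) / 2 ^ m ≤ 1 / 2 ^ n :=
      one_div_le_one_div_of_le (by positivity) (pow_le_pow_right₀ one_le_two hn)
    linarith

theorem abs_sub_le_of_mem_Icc_of_mem_Ico {a ℓ y w : ℝ} (hy : y ∈ Icc a (a + ℓ))
    (hw : w ∈ Ico a (a + ℓ)) : |w - y| ≤ ℓ := by
  rw [abs_le]
  exact ⟨by linarith [hw.1, hy.2], by linarith [hw.2, hy.1]⟩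

/-- On an arc of length `2⁻ⁿ` meeting a region where `g^c ≥ γ`, the function `g^c` varies by a
relative amount at most `(2π/γ) 2⁻ⁿ`. -/
theorem abs_gfun_sub_le_mul {c : Torus} {γ : ℝ} (hγ : 0 < γ) {n : ℕ} {a y : ℝ}
    (hy : y ∈ Icc a (a + 1 / 2 ^ n)) (hyγ : γ ≤ gfun c y) {z : Torus} (hz : z ∈ arc n a) :
    |gfun c z - gfun c y| ≤ gfun c y * (2 * Real.pi / γ * (1 / 2 ^ n)) := by
  obtain ⟨w, hw, rfl⟩ := hz
  have hpi := Real.pi_pos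
  calc |gfun c w - gfun c y| ≤ 2 * Real.pi * |w - y| := abs_gfun_sub_le c w y
    _ ≤ 2 * Real.pi * (1 / 2 ^ n) := by
        gcongr
        exact abs_sub_le_of_mem_Icc_of_mem_Ico hy hw
    _ = γ * (2 * Real.pi / γ * (1 / 2 ^ n)) := by field_simp
    _ ≤ _ := by gcongr

theorem two_mul_mem_Icc {n : ℕ} {a y : ℝ} (hy : y ∈ Icc a (a + 1 / 2 ^ (n + 1))) :
    2 * y ∈ Icc (2 * a) (2 * a + 1 / 2 ^ n) := by
  have hpow : 2 * (1 / 2 ^ (n + 1) : ℝ) = 1 / 2 ^ n := by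
    rw [pow_succ]; field_simp
  exact ⟨by linarith [hy.1], by linarith [hy.2]⟩

theorem prod_gfun_succ (c : Torus) (n : ℕ) (y : ℝ) :
    ∏ k ∈ Finset.range (n + 1), gfun c (dbl^[k] (y : Torus)) =
      gfun c y * ∏ k ∈ Finset.range n, gfun c (dbl^[k] ((2 * y : ℝ) : Torus)) := by
  rw [Finset.prod_range_succ', mul_comm, ← dbl_coe]
  rfl

theorem IsGMeasure.arc_le {c : Torus} {μ : Measure Torus} (hμ : IsGMeasure c μ) {γ : ℝ}
    (hγ : 0 < γ) (n : ℕ) {a y : ℝ} (hy : y ∈ Icc a (a + 1 / 2 ^ n))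
    (hyγ : ∀ k, γ ≤ gfun c (dbl^[k] (y : Torus))) :
    μ.real (arc n a) ≤ Real.exp (2 * Real.pi / γ * (1 - 1 / 2 ^ n)) *
      ∏ k ∈ Finset.range n, gfun c (dbl^[k] (y : Torus)) := by
  have := hμ.1
  induction n generalizing a y with
  | zero => simp
  | succ n ih =>
    set C := 2 * Real.pi / γ
    have hC : 0 ≤ C := by positivity
    have hy0 : γ ≤ gfun c y := hyγ 0
    have hbd : ∀ x ∈ arc (n + 1) a, gfun c x ≤ gfun c y * Real.exp (C * (1 / 2 ^ (n + 1))) := by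
      intro x hx
      have h1 := (abs_le.mp (abs_gfun_sub_le_mul hγ hy hy0 hx)).2
      have h2 := Real.add_one_le_exp (C * (1 / 2 ^ (n + 1)))
      nlinarith [mul_le_mul_of_nonneg_left h2 (gfun_nonneg c y)]
    have h1 := ENNReal.toReal_mono (by finiteness)
      (hμ.le_mul_image_dbl (measurableSet_arc _ _) (injOn_dbl_arc n a) hbd)
    have hpos := mul_nonneg (gfun_nonneg c y) (Real.exp_pos (C * (1 / 2 ^ (n + 1)))).le
    rw [dbl_image_arc, ENNReal.toReal_mul, ENNReal.toReal_ofReal hpos] at h1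
    have h2 := ih (two_mul_mem_Icc hy) fun k => by
      rw [← dbl_coe]; exact hyγ (k + 1)
    have h3 : C * (1 - 1 / 2 ^ (n + 1)) = C * (1 / 2 ^ (n + 1)) + C * (1 - 1 / 2 ^ n) := by
      rw [pow_succ]; field_simp; ring
    rw [prod_gfun_succ, h3, Real.exp_add]
    refine h1.trans ((mul_le_mul_of_nonneg_left h2 hpos).trans_eq ?_)
    ring

theorem exp_neg_two_mul_le_one_sub {t : ℝ} (h0 : 0 ≤ t) (h1 : t ≤ 1 / 2) :
    Real.exp (-(2 * t)) ≤ 1 - t := by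
  rw [Real.exp_neg, inv_le_comm₀ (Real.exp_pos _) (by linarith)]
  refine le_trans ?_ (Real.add_one_le_exp (2 * t))
  rw [inv_le_iff_one_le_mul₀ (by linarith)]
  nlinarith

theorem IsGMeasure.le_arc {c : Torus} {μ : Measure Torus} (hμ : IsGMeasure c μ) {γ κ : ℝ}
    (hγ : 0 < γ) (hκ : 0 ≤ κ) {m : ℕ} (hm : 2 * Real.pi / γ * (1 / 2 ^ m) ≤ 1 / 2)
    (hκm : ∀ n ≤ m, ∀ a : ℝ, κ ≤ μ.real (arc n a)) (n : ℕ) {a y : ℝ}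
    (hy : y ∈ Icc a (a + 1 / 2 ^ n)) (hyγ : ∀ k, γ ≤ gfun c (dbl^[k] (y : Torus))) :
    κ * Real.exp (-(2 * (2 * Real.pi / γ * (1 - 1 / 2 ^ n)))) *
      ∏ k ∈ Finset.range n, gfun c (dbl^[k] (y : Torus)) ≤ μ.real (arc n a) := by
  have := hμ.1
  set C := 2 * Real.pi / γ
  have hC : 0 ≤ C := by positivity
  induction n generalizing a y with
  | zero => simpa using hκm 0 (Nat.zero_le _) a
  | succ n ih =>
    rcases le_or_gt (n + 1) m with hnm | hnm
    · refine le_trans ?_ (hκm _ hnm a)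
      have h1 : ∏ k ∈ Finset.range (n + 1), gfun c (dbl^[k] (y : Torus)) ≤ 1 :=
        Finset.prod_le_one (fun _ _ => gfun_nonneg _ _) fun _ _ => gfun_le_one _ _
      have h2 : (1 : ℝ) / 2 ^ (n + 1) ≤ 1 := by
        rw [div_le_one (by positivity)]
        exact one_le_pow₀ one_le_two
      have h3 : Real.exp (-(2 * (C * (1 - 1 / 2 ^ (n + 1))))) ≤ 1 := by
        rw [Real.exp_le_one_iff, neg_nonpos]
        have : 0 ≤ 1 - (1 : ℝ) / 2 ^ (n + 1) := by linarith
        positivity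
      rw [mul_assoc]
      exact mul_le_of_le_one_right hκ
        (mul_le_one₀ h3 (Finset.prod_nonneg fun _ _ => gfun_nonneg _ _) h1)
    · have hy0 : γ ≤ gfun c y := hyγ 0
      have ht : C * (1 / 2 ^ (n + 1)) ≤ 1 / 2 := by
        refine le_trans (mul_le_mul_of_nonneg_left ?_ hC) hm
        exact one_div_le_one_div_of_le (by positivity) (pow_le_pow_right₀ one_le_two hnm.le)
      have hexp := exp_neg_two_mul_le_one_sub (by positivity) ht
      have hbd : ∀ x ∈ arc (n + 1) a,
          gfun c y * Real.exp (-(2 * (C * (1 / 2 ^ (n + 1))))) ≤ gfun c x := by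
        intro x hx
        have h1 := (abs_le.mp (abs_gfun_sub_le_mul hγ hy hy0 hx)).1
        nlinarith [mul_le_mul_of_nonneg_left hexp (gfun_nonneg c y)]
      have h1 := ENNReal.toReal_mono (by finiteness)
        (hμ.mul_image_dbl_le (measurableSet_arc _ _) hbd)
      have hpos := mul_nonneg (gfun_nonneg c y) (Real.exp_pos (-(2 * (C * (1 / 2 ^ (n + 1)))))).le
      rw [dbl_image_arc, ENNReal.toReal_mul, ENNReal.toReal_ofReal hpos] at h1
      have h2 := ih (two_mul_mem_Icc hy) fun k => by
        rw [← dbl_coe]; exact hyγ (k + 1)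
      have h3 : -(2 * (C * (1 - 1 / 2 ^ (n + 1)))) =
          -(2 * (C * (1 / 2 ^ (n + 1)))) + -(2 * (C * (1 - 1 / 2 ^ n))) := by
        rw [pow_succ]; field_simp; ring
      rw [prod_gfun_succ, h3, Real.exp_add]
      refine le_trans (le_of_eq ?_) ((mul_le_mul_of_nonneg_left h2 hpos).trans h1)
      ring

/-- Without atoms, the endpoints of an arc do not affect its measure. -/
theorem measure_image_coe_eq_arc {μ : Measure Torus} (hna : ∀ x : Torus, μ {x} = 0) {n : ℕ}
    {a : ℝ} {J : Set ℝ} (h₁ : Set.Ioo a (a + 1 / 2 ^ n) ⊆ J)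
    (h₂ : J ⊆ Set.Icc a (a + 1 / 2 ^ n)) :
    μ ((fun y : ℝ => (y : Torus)) '' J) = μ (arc n a) := by
  have hlt : a < a + 1 / 2 ^ n := by simp
  have hins : ∀ (x : Torus) (s : Set Torus), μ (insert x s) ≤ μ s := fun x s => by
    simpa [hna x] using measure_union_le (μ := μ) {x} s
  apply le_antisymm
  · refine (measure_mono (image_mono h₂)).trans ?_
    rw [← Ico_insert_right hlt.le, image_insert_eq]
    exact hins _ _
  · rw [arc, ← Ioo_insert_left hlt, image_insert_eq]
    exact (hins _ _).trans (measure_mono (image_mono h₁))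

/-- for `c ≠ 0`, `0 < δ < 1/2` and a non-atomic `g`-measure `μ` for `g^c`,
there is `R > 0` such that for every `n`, every interval `I ⊆ 𝕋` of length `2^{−n}`, and
every `x ∈ I ∩ K^c_δ`, one has `R⁻¹ exp(ψ^c_n(x)) ≤ μ(I) ≤ R exp(ψ^c_n(x))`. -/
theorem stmt18 (c : Torus) (hc : c ≠ 0) (δ : ℝ) (hδ0 : 0 < δ) (hδ1 : δ < 1 / 2)
    (μ : Measure Torus) (hμ : IsGMeasure c μ) (hna : ∀ x : Torus, μ {x} = 0) :
    ∃ R : ℝ, 0 < R ∧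
      ∀ (n : ℕ) (a : ℝ) (J : Set ℝ),
        Set.Ioo a (a + 1 / 2 ^ n) ⊆ J → J ⊆ Set.Icc a (a + 1 / 2 ^ n) →
        ∀ x ∈ ((fun y : ℝ => (y : Torus)) '' J) ∩ Kdelta c δ,
          R⁻¹ * (eexp (psiSum c n x)).toReal ≤
              (μ ((fun y : ℝ => (y : Torus)) '' J)).toReal ∧
            (μ ((fun y : ℝ => (y : Torus)) '' J)).toReal ≤
              R * (eexp (psiSum c n x)).toReal := by
  have := hμ.1
  obtain ⟨γ, hγ, hγle⟩ := exists_pos_le_gfun c hδ0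
  set C := 2 * Real.pi / γ
  have hC : 0 < C := by positivity
  obtain ⟨m, hm⟩ : ∃ m : ℕ, C * (1 / 2 ^ m) ≤ 1 / 2 := by
    obtain ⟨m, hm⟩ := pow_unbounded_of_one_lt (2 * C) one_lt_two
    refine ⟨m, ?_⟩
    rw [mul_one_div, div_le_iff₀ (by positivity)]
    linarith
  obtain ⟨κ, hκ, hκm⟩ := hμ.exists_pos_le_arc hna m
  have hlow : 0 < κ * Real.exp (-(2 * C)) := by positivity
  refine ⟨max (Real.exp C) (κ * Real.exp (-(2 * C)))⁻¹, lt_max_of_lt_left (Real.exp_pos _), ?_⟩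
  rintro n a J h₁ h₂ _ ⟨⟨y, hyJ, rfl⟩, hyK⟩
  have hyγ : ∀ k, γ ≤ gfun c (dbl^[k] (y : Torus)) := fun k => hγle _ (hyK k)
  have hprod : 0 ≤ ∏ k ∈ Finset.range n, gfun c (dbl^[k] (y : Torus)) :=
    Finset.prod_nonneg fun _ _ => gfun_nonneg _ _
  have hn : 0 ≤ (1 : ℝ) / 2 ^ n := by positivity
  rw [toReal_eexp_psiSum n fun k => (hγ.trans_le (hyγ k)).ne',
    measure_image_coe_eq_arc hna h₁ h₂]
  constructor
  · refine le_trans ?_ (hμ.le_arc hγ hκ.le hm hκm n (h₂ hyJ) hyγ)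
    refine mul_le_mul_of_nonneg_right ?_ hprod
    refine (inv_le_of_inv_le₀ hlow (le_max_right _ _)).trans ?_
    gcongr
    nlinarith
  · refine (hμ.arc_le hγ n (h₂ hyJ) hyγ).trans (mul_le_mul_of_nonneg_right ?_ hprod)
    refine le_trans (Real.exp_le_exp.mpr ?_) (le_max_left _ _)
    nlinarith

end GTM
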